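/- Covering lemma: in the hard instance, with M = ⌊√(log k · log log k)⌋ and Q the set of image paths in G of edges of H whose G-distance is at most (log k)/100, there exists a path P of length M in G' such that any subfamily of Q whose union contains P has size Ω(M / log log k). -/

import Mathlib

open SimpleGraph

variable {V : Type*}

/-- The weighted length of a walk: sum of the weights of its edges (with multiplicity). -/
def wlength {G : SimpleGraph V} (w : V → V → ℝ) {u v : V} (p : G.Walk u v) : ℝ :=
  (p.darts.map (fun d => w d.toProd.1 d.toProd.2)).sum

/-- The weighted shortest-path distance between two vertices. -/
noncomputable def wdist (G : SimpleGraph V) (w : V → V → ℝ) (u v : V) : ℝ :=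
  sInf {l | ∃ p : G.Walk u v, l = wlength w p}

/-- The graph `G` of the hard instance: a copy of `G'` (on the left summand) together with a
pendant terminal `t_u = inr u` attached to each vertex `u = inl u` of `G'`. -/
def bigGraph (G' : SimpleGraph V) : SimpleGraph (V ⊕ V) :=
  SimpleGraph.fromRel (fun x y =>
    (∃ u v, x = Sum.inl u ∧ y = Sum.inl v ∧ G'.Adj u v) ∨ (∃ u, x = Sum.inl u ∧ y = Sum.inr u))

/-- The edge weights of the hard instance: weight `1` on edges of `G'`, weight `M` on each
pendant edge `(u, t_u)`. -/
def bigWeight (M : ℕ) : V ⊕ V → V ⊕ V → ℝ := fun x y =>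
  match x, y with
  | Sum.inl _, Sum.inl _ => 1
  | _, _ => (M : ℝ)

/-- A sequence of pairwise distinct vertices in which consecutive ones are adjacent. -/
def IsVertexPath (G : SimpleGraph V) {n : ℕ} (w : Fin (n + 1) → V) : Prop :=
  Function.Injective w ∧ ∀ i : Fin n, G.Adj (w i.castSucc) (w i.succ)

namespace IsVertexPath

variable {G : SimpleGraph V} {n : ℕ}

lemma tail {w : Fin (n + 2) → V} (hw : IsVertexPath G w) :
    IsVertexPath G (n := n) (Fin.tail w) :=
  ⟨hw.1.comp (Fin.succ_injective _), fun i => hw.2 i.succ⟩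

lemma init {w : Fin (n + 2) → V} (hw : IsVertexPath G w) :
    IsVertexPath G (n := n) (Fin.init w) :=
  ⟨hw.1.comp (Fin.castSucc_injective _), fun i => hw.2 i.castSucc⟩

lemma exists_walk_getVert {w : Fin (n + 1) → V} (hw : IsVertexPath G w) :
    ∃ P : G.Walk (w 0) (w (Fin.last n)), P.length = n ∧ ∀ i : Fin (n + 1), P.getVert i = w i := by
  induction n with
  | zero => exact ⟨Walk.nil, rfl, fun i => by rw [Fin.fin_one_eq_zero i]; rfl⟩
  | succ n ih =>
    obtain ⟨P, hl, hP⟩ := ih hw.tail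
    refine ⟨Walk.cons (hw.2 0) P, congrArg (· + 1) hl, fun i => ?_⟩
    cases i using Fin.cases with
    | zero => rfl
    | succ i => exact hP i

lemma exists_path_getVert {w : Fin (n + 1) → V} (hw : IsVertexPath G w) :
    ∃ P : G.Walk (w 0) (w (Fin.last n)), P.IsPath ∧ P.length = n ∧
      ∀ i : Fin (n + 1), P.getVert i = w i := by
  obtain ⟨P, hl, hP⟩ := hw.exists_walk_getVert
  refine ⟨P, (Walk.IsPath.getVert_injOn_iff P).1 fun i hi j hj h => ?_, hl, hP⟩
  rw [Set.mem_ofPred_eq, hl] at hi hj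
  have := hP ⟨i, by omega⟩
  have := hP ⟨j, by omega⟩
  have := @hw.1 ⟨i, by omega⟩ ⟨j, by omega⟩ (by simp_all)
  simpa using this

/-- Paths of length less than half the girth are determined by their endpoints. -/
lemma eq_of_endpoints_eq (hg : ∀ (a : V) (c : G.Walk a a), c.IsCycle → 2 * n < c.length)
    {w w' : Fin (n + 1) → V} (hw : IsVertexPath G w) (hw' : IsVertexPath G w')
    (h0 : w 0 = w' 0) (hlast : w (Fin.last n) = w' (Fin.last n)) : w = w' := by
  obtain ⟨P, hP, hl, hPw⟩ := hw.exists_path_getVert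
  obtain ⟨P', hP', hl', hPw'⟩ := hw'.exists_path_getVert
  have : P = P'.copy h0.symm hlast.symm := by
    by_contra hne
    obtain ⟨x, -, -, c, hc, hcl⟩ :=
      hP.exists_isCycle_length_le_add_of_ne ((Walk.isPath_copy _ _ _).2 hP') hne
    have := hg x c hc
    simp only [Walk.length_copy] at hcl
    omega
  funext i
  rw [← hPw, ← hPw', this, Walk.getVert_copy]

/-- A path shorter than the girth extends along every edge except the one it arrived by. -/
lemma snoc (hg : ∀ (a : V) (c : G.Walk a a), c.IsCycle → n + 2 < c.length)
    {w : Fin (n + 2) → V} (hw : IsVertexPath G w) {z : V}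
    (hz : G.Adj (w (Fin.last _)) z) (hne : z ≠ w (Fin.last n).castSucc) :
    IsVertexPath G (n := n + 2) (Fin.snoc w z) := by
  classical
  refine ⟨Fin.snoc_injective_iff.2 ⟨hw.1, ?_⟩, fun i => ?_⟩
  · rintro ⟨i, rfl⟩
    obtain ⟨P, hP, hl, hPw⟩ := hw.exists_path_getVert
    have hmem : w i ∈ P.support := hPw i ▸ P.getVert_mem_support _
    by_cases heq : P.dropUntil _ hmem = Walk.cons hz.symm Walk.nil
    · have he : s(w (Fin.last _), w i) ∈ P.edges := by
        apply P.edges_dropUntil_subset_edges hmem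
        rw [heq]
        simp [Sym2.eq_swap]
      apply hne
      rw [hP.eq_penultimate_of_mem_edges he, Walk.penultimate, hl]
      exact hPw (Fin.last n).castSucc
    · obtain ⟨x, -, -, c, hc, hcl⟩ := (hP.dropUntil hmem).exists_isCycle_length_le_add_of_ne
        (Walk.IsPath.of_adj hz.symm) heq
      have := hg x c hc
      have := P.length_dropUntil_le_length hmem
      simp at hcl
      omega
  · cases i using Fin.lastCases with
    | last => simpa [Fin.succ_last] using hz
    | cast i =>
      rw [Fin.succ_castSucc, Fin.snoc_castSucc, Fin.snoc_castSucc]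
      exact hw.2 i

end IsVertexPath

section Counting

variable [Fintype V] {G : SimpleGraph V}

open Classical in
/-- The set of paths with `n` edges, as vertex sequences. -/
noncomputable def vertexPaths (G : SimpleGraph V) (n : ℕ) : Finset (Fin (n + 1) → V) :=
  Finset.univ.filter (IsVertexPath G)

lemma mem_vertexPaths {n : ℕ} {w : Fin (n + 1) → V} :
    w ∈ vertexPaths G n ↔ IsVertexPath G w := by
  simp [vertexPaths]

variable [DecidableRel G.Adj]

open Classical in
lemma card_erase_neighborFinset (hd : ∀ v, G.degree v = 3) {u v : V} (h : G.Adj u v) :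
    ((G.neighborFinset v).erase u).card = 2 := by
  rw [Finset.card_erase_of_mem (by simpa using h.symm), G.card_neighborFinset_eq_degree, hd]

lemma mul_card_vertexPaths_le (hd : ∀ v, G.degree v = 3) {n : ℕ}
    (hg : ∀ (a : V) (c : G.Walk a a), c.IsCycle → n + 2 < c.length) :
    2 * (vertexPaths G (n + 1)).card ≤ (vertexPaths G (n + 2)).card := by
  classical
  apply Finset.mul_card_image_le_card_of_maps_to (f := fun w : Fin (n + 3) → V => Fin.init w)
  · intro w hw
    exact mem_vertexPaths.2 (mem_vertexPaths.1 hw).init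
  · intro w hw
    have hw := mem_vertexPaths.1 hw
    have hadj : G.Adj (w (Fin.last n).castSucc) (w (Fin.last _)) := hw.2 (Fin.last n)
    refine (card_erase_neighborFinset hd hadj).ge.trans ?_
    refine Finset.card_le_card_of_injOn (fun z => Fin.snoc w z) ?_ ?_
    · intro z hz
      simp only [Finset.coe_erase, Set.mem_sdiff, Finset.mem_coe, mem_neighborFinset,
        Set.mem_singleton_iff] at hz
      simp only [Finset.coe_filter, Set.mem_ofPred_eq, mem_vertexPaths]
      exact ⟨hw.snoc hg hz.1 hz.2, Fin.init_snoc _ _⟩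
    · exact (Fin.snoc_right_injective (α := fun _ => V) w).injOn

lemma card_vertexPaths_one_ge (hd : ∀ v, G.degree v = 3) :
    2 * Fintype.card V ≤ (vertexPaths G 1).card := by
  classical
  have h : Fintype.card V * 3 = (Finset.univ.sigma fun v => G.neighborFinset v).card := by
    simp [hd]
  have : (Finset.univ.sigma fun v => G.neighborFinset v).card ≤ (vertexPaths G 1).card := by
    refine Finset.card_le_card_of_injOn (fun p => ![p.1, p.2]) ?_ ?_
    · rintro ⟨u, v⟩ h
      simp only [Finset.coe_sigma, Set.mem_sigma_iff, Finset.mem_coe, mem_neighborFinset] at h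
      simp only [Finset.mem_coe, mem_vertexPaths]
      refine ⟨?_, fun i => ?_⟩
      · intro i j hij
        fin_cases i <;> fin_cases j <;> simp_all [h.2.ne, h.2.ne']
      · fin_cases i; simpa using h.2
    · rintro ⟨u, v⟩ - ⟨u', v'⟩ - h
      have h0 := congrFun h 0
      have h1 := congrFun h 1
      simp_all
  omega

lemma card_vertexPaths_ge (hd : ∀ v, G.degree v = 3) {n : ℕ}
    (hg : ∀ (a : V) (c : G.Walk a a), c.IsCycle → n + 1 < c.length) :
    2 ^ (n + 1) * Fintype.card V ≤ (vertexPaths G (n + 1)).card := by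
  induction n with
  | zero => simpa using card_vertexPaths_one_ge hd
  | succ n ih =>
    have := ih fun a c hc => by have := hg a c hc; omega
    have := mul_card_vertexPaths_le hd (n := n) hg
    rw [pow_succ]
    linarith

open Classical in
lemma card_filter_init_eq_le (hd : ∀ v, G.degree v = 3) {n : ℕ} {u : Fin (n + 2) → V}
    (hu : IsVertexPath G u) :
    ((vertexPaths G (n + 2)).filter fun w => Fin.init (n := n + 2) w = u).card ≤ 2 := by
  have hadj : G.Adj (u (Fin.last n).castSucc) (u (Fin.last _)) := hu.2 (Fin.last n)
  refine le_of_le_of_eq ?_ (card_erase_neighborFinset hd hadj)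
  refine Finset.card_le_card_of_injOn (fun w => w (Fin.last _)) ?_ ?_
  · intro w hw
    simp only [Finset.coe_filter, Set.mem_ofPred_eq, mem_vertexPaths] at hw
    obtain ⟨hw, rfl⟩ := hw
    simp only [Finset.coe_erase, Set.mem_sdiff, Finset.mem_coe, mem_neighborFinset,
      Set.mem_singleton_iff]
    exact ⟨hw.2 (Fin.last _), fun h => absurd (hw.1 h) (by simp [Fin.ext_iff])⟩
  · intro w hw w' hw' h
    simp only [Finset.coe_filter, Set.mem_ofPred_eq] at hw hw' h
    rw [← Fin.snoc_init_self w, ← Fin.snoc_init_self w', hw.2, hw'.2, h]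

open Classical in
lemma card_filter_tail_eq_le (hd : ∀ v, G.degree v = 3) {n : ℕ} {u : Fin (n + 2) → V}
    (hu : IsVertexPath G u) :
    ((vertexPaths G (n + 2)).filter fun w => Fin.tail (n := n + 2) w = u).card ≤ 2 := by
  have hadj : G.Adj (u 1) (u 0) := (hu.2 0).symm
  refine le_of_le_of_eq ?_ (card_erase_neighborFinset hd hadj)
  refine Finset.card_le_card_of_injOn (fun w => w 0) ?_ ?_
  · intro w hw
    simp only [Finset.coe_filter, Set.mem_ofPred_eq, mem_vertexPaths] at hw
    obtain ⟨hw, rfl⟩ := hw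
    simp only [Finset.coe_erase, Set.mem_sdiff, Finset.mem_coe, mem_neighborFinset,
      Set.mem_singleton_iff]
    exact ⟨(hw.2 0).symm, fun h => absurd (hw.1 h) (Fin.succ_ne_zero _).symm⟩
  · intro w hw w' hw' h
    simp only [Finset.coe_filter, Set.mem_ofPred_eq] at hw hw' h
    rw [← Fin.cons_self_tail w, ← Fin.cons_self_tail w', hw.2, hw'.2, h]

open Classical in
/-- The paths of length `n` below half the girth that visit `x` at time `i` and `y` at time `j`. -/
lemma card_vertexPaths_filter_le (hd : ∀ v, G.degree v = 3) {n : ℕ}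
    (hg : ∀ (a : V) (c : G.Walk a a), c.IsCycle → 2 * n < c.length)
    (i j : Fin (n + 1)) (hij : i < j) (x y : V) :
    ((vertexPaths G n).filter fun w => w i = x ∧ w j = y).card * 2 ^ (j - i : ℕ) ≤ 2 ^ n := by
  induction n with
  | zero => exact absurd hij (by simp [Fin.fin_one_eq_zero])
  | succ n ih =>
    have hg' : ∀ (a : V) (c : G.Walk a a), c.IsCycle → 2 * n < c.length := fun a c hc => by
      have := hg a c hc; omega
    have hn : ∀ i' j' : Fin (n + 1), i' < j' → ∃ m, n = m + 1 := fun i' j' h =>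
      Nat.exists_eq_succ_of_ne_zero (by rintro rfl; simp [Fin.fin_one_eq_zero] at h)
    have key : ∀ (i' j' : Fin (n + 1)) (f : (Fin (n + 2) → V) → (Fin (n + 1) → V)), i' < j' →
        (j' - i' : ℕ) = j - i →
        (∀ w, IsVertexPath G w → IsVertexPath G (f w)) →
        (∀ w, f w i' = w i) → (∀ w, f w j' = w j) →
        (∀ u, IsVertexPath G u →
          ((vertexPaths G (n + 1)).filter fun w => f w = u).card ≤ 2) →
        ((vertexPaths G (n + 1)).filter fun w => w i = x ∧ w j = y).card * 2 ^ (j - i : ℕ)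
          ≤ 2 ^ (n + 1) := by
      intro i' j' f hij' hsub hf hi hj hfib
      have h1 := ih hg' i' j' hij'
      have h2 : ((vertexPaths G (n + 1)).filter fun w => w i = x ∧ w j = y).card ≤
          2 * ((vertexPaths G n).filter fun w => w i' = x ∧ w j' = y).card := by
        apply Finset.card_le_mul_card_image_of_maps_to (f := f)
        · intro w hw
          simp only [Finset.mem_filter, mem_vertexPaths] at hw ⊢
          exact ⟨hf _ hw.1, by rw [hi, hj]; exact hw.2⟩
        · intro u hu
          refine le_trans (Finset.card_le_card ?_)
            (hfib u (mem_vertexPaths.1 (Finset.mem_filter.1 hu).1))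
          exact Finset.filter_subset_filter _ (Finset.filter_subset _ _)
      rw [hsub] at h1
      calc _ ≤ _ := Nat.mul_le_mul_right _ h2
        _ ≤ _ := by rw [pow_succ, mul_assoc, mul_comm]; exact Nat.mul_le_mul_right _ h1
    by_cases hj : j = Fin.last _
    · by_cases hi : i = 0
      · subst hi hj
        have : ((vertexPaths G (n + 1)).filter
            fun w => w 0 = x ∧ w (Fin.last _) = y).card ≤ 1 := by
          refine Finset.card_le_one.2 fun w hw w' hw' => ?_
          simp only [Finset.mem_filter, mem_vertexPaths] at hw hw'
          exact hw.1.eq_of_endpoints_eq hg hw'.1 (hw.2.1.trans hw'.2.1.symm)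
            (hw.2.2.trans hw'.2.2.symm)
        simpa using Nat.mul_le_mul_right (2 ^ (n + 1)) this
      · obtain ⟨i', rfl⟩ := Fin.exists_succ_eq.2 hi
        have hj0 : j ≠ 0 := by rintro rfl; simp at hij
        obtain ⟨j', rfl⟩ := Fin.exists_succ_eq.2 hj0
        refine key i' j' (fun w => Fin.tail w) (by simpa using hij) (by simp) (fun w hw => hw.tail)
          (fun w => rfl) (fun w => rfl) fun u hu => ?_
        obtain ⟨m, rfl⟩ := hn i' j' (by simpa using hij)
        exact card_filter_tail_eq_le hd hu
    · obtain ⟨j', rfl⟩ := Fin.exists_castSucc_eq.2 hj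
      have hi : i ≠ Fin.last _ := (hij.trans (Fin.castSucc_lt_last j')).ne
      obtain ⟨i', rfl⟩ := Fin.exists_castSucc_eq.2 hi
      refine key i' j' (fun w => Fin.init w) (by simpa using hij) (by simp) (fun w hw => hw.init)
        (fun w => rfl) (fun w => rfl) fun u hu => ?_
      obtain ⟨m, rfl⟩ := hn i' j' (by simpa using hij)
      exact card_filter_init_eq_le hd hu

/-- Given few small vertex sets, some path meets each of them only within a short time window. -/
lemma exists_isVertexPath_forall_lt_add {ι : Type*} (hd : ∀ v, G.degree v = 3) {M N ℓ : ℕ}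
    (hM : 1 ≤ M) (hg : ∀ (a : V) (c : G.Walk a a), c.IsCycle → 2 * M < c.length)
    (Q : Finset ι) (hQ : Q.card ≤ 6 * Fintype.card V) (A : ι → Finset V)
    (hA : ∀ p ∈ Q, (A p).card ≤ N) (hV : 0 < Fintype.card V) (hMN : M + 1 ≤ N)
    (hℓ : 6 * N ^ 4 < 2 ^ ℓ) :
    ∃ w : Fin (M + 1) → V, IsVertexPath G w ∧
      ∀ p ∈ Q, ∀ i j, w i ∈ A p → w j ∈ A p → (j : ℕ) < i + ℓ := by
  classical
  by_contra! hcon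
  have hℓ0 : 0 < ℓ := by
    rcases Nat.eq_zero_or_pos ℓ with rfl | h
    · have : 1 ≤ N ^ 4 := Nat.one_le_pow _ _ (by omega)
      omega
    · exact h
  set D : Finset (Fin (M + 1) × Fin (M + 1)) :=
    Finset.univ.filter fun ij => (ij.1 : ℕ) + ℓ ≤ ij.2 with hD
  have hDcard : D.card ≤ N ^ 2 := by
    refine (Finset.card_filter_le _ _).trans ?_
    simpa [sq] using Nat.mul_le_mul hMN hMN
  have hsub : vertexPaths G M ⊆ Q.biUnion fun p => D.biUnion fun ij =>
      (A p ×ˢ A p).biUnion fun xy =>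
        (vertexPaths G M).filter fun w => w ij.1 = xy.1 ∧ w ij.2 = xy.2 := by
    intro w hw
    obtain ⟨p, hp, i, j, hi, hj, hij⟩ := hcon w (mem_vertexPaths.1 hw)
    simp only [Finset.mem_biUnion]
    exact ⟨p, hp, (i, j), by simpa [hD] using hij, (w i, w j), by simp [hi, hj], by simp [hw]⟩
  have hcard : (vertexPaths G M).card ≤
      6 * Fintype.card V * (N ^ 2 * (N ^ 2 * (2 ^ M / 2 ^ ℓ))) := by
    refine (Finset.card_le_card hsub).trans <|
      (Finset.card_biUnion_le_card_mul _ _ (N ^ 2 * (N ^ 2 * (2 ^ M / 2 ^ ℓ))) ?_).trans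
        (Nat.mul_le_mul_right _ hQ)
    intro p hp
    refine (Finset.card_biUnion_le_card_mul _ _ (N ^ 2 * (2 ^ M / 2 ^ ℓ)) ?_).trans
      (Nat.mul_le_mul_right _ hDcard)
    rintro ⟨i, j⟩ hij
    refine (Finset.card_biUnion_le_card_mul _ _ (2 ^ M / 2 ^ ℓ) ?_).trans
      (Nat.mul_le_mul_right _ ?_)
    · rintro ⟨x, y⟩ -
      have hij : (i : ℕ) + ℓ ≤ j := by simpa [hD] using hij
      rw [Nat.le_div_iff_mul_le (by positivity)]
      refine le_trans (Nat.mul_le_mul_left _ (Nat.pow_le_pow_right (by norm_num) ?_))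
        (card_vertexPaths_filter_le hd hg i j (Fin.lt_def.2 (by omega)) x y)
      omega
    · rw [Finset.card_product, sq]
      exact Nat.mul_le_mul (hA p hp) (hA p hp)
  have hlow : 2 ^ M * Fintype.card V ≤ (vertexPaths G M).card := by
    obtain ⟨m, rfl⟩ := Nat.exists_eq_add_of_le' hM
    exact card_vertexPaths_ge hd fun a c hc => by have := hg a c hc; omega
  have hdiv : 2 ^ M / 2 ^ ℓ * 2 ^ ℓ ≤ 2 ^ M := Nat.div_mul_le_self _ _
  have hpos : 0 < 2 ^ M * Fintype.card V := by positivity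
  have : 2 ^ M * Fintype.card V * 2 ^ ℓ ≤ 2 ^ M * Fintype.card V * (6 * N ^ 4) :=
    calc _ ≤ _ := Nat.mul_le_mul_right _ (hlow.trans hcard)
      _ = 6 * Fintype.card V * N ^ 4 * (2 ^ M / 2 ^ ℓ * 2 ^ ℓ) := by ring
      _ ≤ 6 * Fintype.card V * N ^ 4 * 2 ^ M := Nat.mul_le_mul_left _ hdiv
      _ = _ := by ring
  exact absurd (Nat.le_of_mul_le_mul_left this hpos) (by omega)

end Counting

lemma ncard_edgeSet_bigGraph_le [Fintype V] (G : SimpleGraph V) [DecidableRel G.Adj]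
    (hd : ∀ v, G.degree v = 3) : (bigGraph G).edgeSet.ncard ≤ 3 * Fintype.card V := by
  classical
  have hsub : (bigGraph G).edgeSet ⊆ Sym2.map Sum.inl '' G.edgeSet ∪
      Set.range fun u : V => (s(Sum.inl u, Sum.inr u) : Sym2 (V ⊕ V)) := by
    intro e
    induction e with | _ x y => ?_
    rw [mem_edgeSet, bigGraph, fromRel_adj]
    rintro ⟨-, (⟨u, v, rfl, rfl, h⟩ | ⟨u, rfl, rfl⟩) | ⟨u, v, rfl, rfl, h⟩ | ⟨u, rfl, rfl⟩⟩
    · exact Or.inl ⟨s(u, v), h, rfl⟩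
    · exact Or.inr ⟨u, rfl⟩
    · exact Or.inl ⟨s(v, u), h.symm, rfl⟩
    · exact Or.inr ⟨u, Sym2.eq_swap⟩
  have hE : G.edgeSet.ncard ≤ 2 * Fintype.card V := by
    have := G.sum_degrees_eq_twice_card_edges
    simp only [hd, Finset.sum_const, Finset.card_univ, smul_eq_mul] at this
    rw [← coe_edgeFinset, Set.ncard_coe_finset]
    omega
  have hR : (Set.range fun u : V => (s(Sum.inl u, Sum.inr u) : Sym2 (V ⊕ V))).ncard
      ≤ Fintype.card V := by
    rw [← Set.image_univ, ← Nat.card_eq_fintype_card, ← Set.ncard_univ]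
    exact Set.ncard_image_le
  have h1 := Set.ncard_le_ncard hsub
  have h2 := Set.ncard_union_le (Sym2.map Sum.inl '' G.edgeSet)
    (Set.range fun u : V => (s(Sum.inl u, Sum.inr u) : Sym2 (V ⊕ V)))
  have h3 : (Sym2.map (Sum.inl : V → V ⊕ V) '' G.edgeSet).ncard ≤ G.edgeSet.ncard :=
    Set.ncard_image_le
  omega

lemma card_le_two_mul_ncard_edgeSet [Fintype V] (H : SimpleGraph V) (Q : Finset (V × V))
    (hQ : ∀ p ∈ Q, H.Adj p.1 p.2) : Q.card ≤ 2 * H.edgeSet.ncard := by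
  classical
  rw [← coe_edgeFinset, Set.ncard_coe_finset, ← H.dart_card_eq_twice_card_edges]
  calc Q.card ≤ (Finset.univ.image fun d : H.Dart => d.toProd).card :=
        Finset.card_le_card fun p hp => Finset.mem_image.2 ⟨⟨p, hQ p hp⟩, Finset.mem_univ _, rfl⟩
    _ ≤ _ := Finset.card_image_le

lemma length_le_wlength {G : SimpleGraph V} {w : V → V → ℝ} (hw : ∀ x y, 1 ≤ w x y) {u v : V}
    (p : G.Walk u v) : (p.length : ℝ) ≤ wlength w p := by
  induction p with
  | nil => simp [wlength]
  | @cons u' v' _ h p ih =>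
    simp only [wlength, Walk.length_cons, Walk.darts_cons, List.map_cons, List.sum_cons] at ih ⊢
    push_cast
    linarith [hw u' v']

lemma one_le_bigWeight {M : ℕ} (hM : 1 ≤ M) (x y : V ⊕ V) : 1 ≤ bigWeight M x y := by
  have : (1 : ℝ) ≤ M := by exact_mod_cast hM
  unfold bigWeight
  split <;> simp [this]

open Classical in
lemma card_filter_inl_mem_support_le [Fintype V] {G : SimpleGraph (V ⊕ V)}
    {a b : V ⊕ V} (p : G.Walk a b) :
    (Finset.univ.filter fun x : V => Sum.inl x ∈ p.support).card ≤ p.length + 1 := by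
  rw [← p.length_support]
  refine le_trans ?_ p.support.toFinset_card_le
  exact Finset.card_le_card_of_injOn Sum.inl
    (fun x hx => List.mem_toFinset.2 (Finset.mem_filter.1 hx).2) Sum.inl_injective.injOn

/-- If each index in `s` covers only times within a window of length `ℓ`, then covering
`M` times takes at least `M / ℓ` indices. -/
lemma le_card_mul_of_windows {ι : Type*} {M ℓ : ℕ} (s : Finset ι) (I : ι → ℕ → Prop)
    (hcov : ∀ i < M, ∃ p ∈ s, I p i)
    (hwin : ∀ p ∈ s, ∀ i < M, ∀ j < M, I p i → I p j → j < i + ℓ) : M ≤ s.card * ℓ := by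
  classical
  have hsub : Finset.range M ⊆ s.biUnion fun p => (Finset.range M).filter (I p) := by
    intro i hi
    obtain ⟨p, hp, h⟩ := hcov i (Finset.mem_range.1 hi)
    exact Finset.mem_biUnion.2 ⟨p, hp, Finset.mem_filter.2 ⟨hi, h⟩⟩
  calc M = (Finset.range M).card := (Finset.card_range M).symm
    _ ≤ _ := Finset.card_le_card hsub
    _ ≤ _ := Finset.card_biUnion_le_card_mul _ _ _ fun p hp => ?_
  rcases ((Finset.range M).filter (I p)).eq_empty_or_nonempty with h | h
  · simp [h]
  · have hmin := Finset.min'_mem _ h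
    refine (Finset.card_le_card (t := Finset.Ico (Finset.min' _ h) (Finset.min' _ h + ℓ))
      fun j hj => Finset.mem_Ico.2 ⟨Finset.min'_le _ _ hj, ?_⟩).trans (by simp)
    rw [Finset.mem_filter, Finset.mem_range] at hmin hj
    exact hwin p hp _ hmin.1 j hj.1 hmin.2 hj.2

lemma eventually_logb_logb_bounds :
    ∀ᶠ k : ℕ in Filter.atTop, 1000 ≤ Real.logb 2 k ∧ 1 ≤ Real.logb 2 (Real.logb 2 k) ∧
      Real.logb 2 (Real.logb 2 k) ≤ Real.logb 2 k / 1000 := by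
  have hL : Filter.Tendsto (fun k : ℕ => Real.logb 2 k) Filter.atTop Filter.atTop :=
    (Real.tendsto_logb_atTop (by norm_num)).comp tendsto_natCast_atTop_atTop
  have hx : ∀ᶠ x : ℝ in Filter.atTop,
      1000 ≤ x ∧ 1 ≤ Real.logb 2 x ∧ Real.logb 2 x ≤ x / 1000 := by
    have h2 : 0 < Real.log 2 := Real.log_pos (by norm_num)
    filter_upwards [Filter.eventually_ge_atTop 1000,
      (Real.tendsto_logb_atTop (b := 2) (by norm_num)).eventually_ge_atTop 1,
      Real.isLittleO_log_id_atTop.bound (c := Real.log 2 / 1000) (by positivity)] with x h1 h3 h4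
    refine ⟨h1, h3, ?_⟩
    rw [Real.logb, div_le_iff₀ h2]
    have := (le_abs_self _).trans h4
    rw [id, Real.norm_of_nonneg (by linarith)] at this
    linarith
  exact hL.eventually hx

/-- covering lemma: there are `c > 0` and `k₀` such that the following holds
for all `k ≥ k₀` in the hard instance (3-regular `G'` on `k` vertices with girth at least
`log₂(k)/10`, pendant terminal edges of weight `M = ⌊√(log₂ k · log₂ log₂ k)⌋`, and `H` a
weighted graph on the terminals with `|E(H)| ≤ |E(G)|`).  Let `𝒬` consist of, for each edge
`(t_u, t_v)` of `H` with `dist_G(t_u, t_v) ≤ log₂(k)/100`, a chosen shortest `t_u`-`t_v` path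
`R u v` in `G` (its image path).  Then there is a path `P` of length `M` in `G'` such that any
subfamily of `𝒬` whose union contains `P` has size at least `c · M / log₂ log₂ k`. -/
theorem covering_lemma :
    ∃ c : ℝ, 0 < c ∧ ∃ k₀ : ℕ, ∀ (V : Type) [Fintype V] (k M : ℕ),
      k₀ ≤ k →
      ∀ (G' : SimpleGraph V) [DecidableRel G'.Adj],
        Fintype.card V = k →
        (∀ v : V, G'.degree v = 3) →
        (∀ (a : V) (c' : G'.Walk a a), c'.IsCycle → Real.logb 2 k / 10 ≤ c'.length) →
        M = ⌊Real.sqrt (Real.logb 2 k * Real.logb 2 (Real.logb 2 k))⌋₊ →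
        ∀ (H : SimpleGraph V),
          H.edgeSet.ncard ≤ (bigGraph G').edgeSet.ncard →
          ∀ (R : ∀ u v : V, H.Adj u v → (bigGraph G').Walk (Sum.inr u) (Sum.inr v)),
            (∀ (u v : V) (h : H.Adj u v), (R u v h).IsPath ∧
              wlength (bigWeight M) (R u v h)
                = wdist (bigGraph G') (bigWeight M) (Sum.inr u) (Sum.inr v)) →
            ∃ (a b : V) (P : G'.Walk a b), P.IsPath ∧ P.length = M ∧
              ∀ s : Finset (V × V),
                (∀ p ∈ s, ∃ h : H.Adj p.1 p.2,
                  wdist (bigGraph G') (bigWeight M) (Sum.inr p.1) (Sum.inr p.2)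
                    ≤ Real.logb 2 k / 100) →
                (∀ e ∈ P.edges, ∃ p ∈ s, ∃ h : H.Adj p.1 p.2,
                  e.map Sum.inl ∈ (R p.1 p.2 h).edges) →
                c * (M / Real.logb 2 (Real.logb 2 k)) ≤ s.card := by
  obtain ⟨k₀, hk₀⟩ := Filter.eventually_atTop.1 eventually_logb_logb_bounds
  refine ⟨1 / 6, by norm_num, k₀, ?_⟩
  intro V _ k M hk G' _ hcard hd hgirth hM H hH R hR
  classical
  obtain ⟨hL, hT, hTL⟩ := hk₀ k hk
  have hkpos : 0 < k := by
    rcases Nat.eq_zero_or_pos k with rfl | h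
    · norm_num at hL
    · exact h
  set L := Real.logb 2 k with hLdef
  set T := Real.logb 2 L with hTdef
  have hM1 : 1 ≤ M := by
    rw [hM, Nat.one_le_floor_iff, Real.one_le_sqrt]
    nlinarith
  have hMle : (M : ℝ) ≤ L / 30 := by
    rw [hM]
    refine (Nat.floor_le (Real.sqrt_nonneg _)).trans (Real.sqrt_le_iff.2 ⟨by linarith, ?_⟩)
    nlinarith
  have hg : ∀ (a : V) (c : G'.Walk a a), c.IsCycle → 2 * M < c.length := by
    intro a c hc
    have := hgirth a c hc
    have : ((2 * M : ℕ) : ℝ) < c.length := by push_cast; linarith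
    exact_mod_cast this
  set Q : Finset (V × V) := Finset.univ.filter fun p => ∃ _ : H.Adj p.1 p.2,
    wdist (bigGraph G') (bigWeight M) (Sum.inr p.1) (Sum.inr p.2) ≤ L / 100 with hQ
  have hQcard : Q.card ≤ 6 * Fintype.card V := by
    have h1 := card_le_two_mul_ncard_edgeSet H Q fun p hp => (Finset.mem_filter.1 hp).2.1
    have h2 := ncard_edgeSet_bigGraph_le G' hd
    omega
  set A : V × V → Finset V := fun p => Finset.univ.filter fun x =>
    ∃ h : H.Adj p.1 p.2, Sum.inl x ∈ (R p.1 p.2 h).support with hA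
  have hAcard : ∀ p ∈ Q, (A p).card ≤ ⌊L⌋₊ := by
    intro p hp
    obtain ⟨h, hdist⟩ := (Finset.mem_filter.1 hp).2
    have hAp : A p = Finset.univ.filter fun x => Sum.inl x ∈ (R p.1 p.2 h).support := by
      simp [hA, h]
    rw [hAp]
    refine (card_filter_inl_mem_support_le _).trans (Nat.le_floor ?_)
    have hlen := length_le_wlength (one_le_bigWeight hM1) (R p.1 p.2 h)
    rw [(hR _ _ h).2] at hlen
    push_cast
    linarith
  have hℓ : 6 * ⌊L⌋₊ ^ 4 < 2 ^ ⌈5 * T⌉₊ := by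
    have hfl : (⌊L⌋₊ : ℝ) ≤ L := Nat.floor_le (by linarith)
    have h1 : (2 : ℝ) ^ (5 * T) ≤ 2 ^ ⌈5 * T⌉₊ := by
      rw [← Real.rpow_natCast]
      exact Real.rpow_le_rpow_of_exponent_le (by norm_num) (Nat.le_ceil _)
    have h2 : (2 : ℝ) ^ (5 * T) = L ^ 5 := by
      rw [mul_comm, Real.rpow_mul (by norm_num), hTdef,
        Real.rpow_logb (by norm_num) (by norm_num) (by linarith)]
      exact_mod_cast Real.rpow_natCast L 5
    have h3 : (6 : ℝ) * ⌊L⌋₊ ^ 4 ≤ 6 * L ^ 4 := by gcongr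
    have h4 : (6 : ℝ) * L ^ 4 < L ^ 5 := by
      have : 0 < L ^ 4 := by positivity
      nlinarith
    have : ((6 * ⌊L⌋₊ ^ 4 : ℕ) : ℝ) < (2 ^ ⌈5 * T⌉₊ : ℕ) := by
      push_cast
      linarith
    exact_mod_cast this
  obtain ⟨w, hw, hwin⟩ := exists_isVertexPath_forall_lt_add hd hM1 hg Q hQcard A hAcard
    (hcard ▸ hkpos) (Nat.le_floor (a := L) (by push_cast; linarith)) hℓ
  obtain ⟨P, hP, hPl, hPw⟩ := hw.exists_path_getVert
  refine ⟨_, _, P, hP, hPl, fun s hs hcov => ?_⟩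
  have hmain : M ≤ s.card * ⌈5 * T⌉₊ := by
    refine le_card_mul_of_windows s (fun p i => P.getVert i ∈ A p) ?_ ?_
    · intro i hi
      have hedge : s(P.getVert i, P.getVert (i + 1)) ∈ P.edges :=
        (Walk.mk_mem_edges_iff_exists P).2 ⟨i, by omega, rfl⟩
      obtain ⟨p, hp, h, he⟩ := hcov _ hedge
      refine ⟨p, hp, Finset.mem_filter.2 ⟨Finset.mem_univ _, h, ?_⟩⟩
      rw [Sym2.map_mk] at he
      exact Walk.fst_mem_support_of_mem_edges _ he
    · intro p hp i hi j hj hiA hjA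
      have hpQ : p ∈ Q := Finset.mem_filter.2 ⟨Finset.mem_univ _, hs p hp⟩
      have hi' := hPw ⟨i, by omega⟩
      have hj' := hPw ⟨j, by omega⟩
      exact hwin p hpQ ⟨i, by omega⟩ ⟨j, by omega⟩ (hi' ▸ hiA) (hj' ▸ hjA)
  have hceil : (⌈5 * T⌉₊ : ℝ) ≤ 6 * T := by
    have := Nat.ceil_lt_add_one (a := 5 * T) (by linarith)
    linarith
  have hMr : (M : ℝ) ≤ s.card * (6 * T) :=
    (by exact_mod_cast hmain : (M : ℝ) ≤ s.card * (⌈5 * T⌉₊ : ℝ)).trans (by gcongr)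
  rw [one_div, ← div_eq_inv_mul, div_div, div_le_iff₀ (by positivity)]
  linarith
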